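/- Let E and F be finite-dimensional real inner product spaces, let 0 < c ≤ C, let t ≥ 0, and let V_t : E × F → ℝ satisfy c(1 + ct)^{−1} I_E ⊕ c I_F ≤ HV_t ≤ C(1 + Ct)^{−1} I_E ⊕ C I_F. Then for all x, x' ∈ E and y, y' ∈ F: ⟨∇_x V_t(x, y) − ∇_x V_t(x', y'), x − x'⟩ ≤ (C/(1+Ct)) ‖x − x'‖² + ((C−c)/((1+Ct)^{1/2}(1+ct)^{1/2})) ‖x − x'‖ ‖y − y'‖, and ⟨∇_x V_t(x, y) − ∇_x V_t(x', y'), x − x'⟩ ≥ (c/(1+ct)) ‖x − x'‖² − ((C−c)/((1+Ct)^{1/2}(1+ct)^{1/2})) ‖x − x'‖ ‖y − y'‖. -/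

import Mathlib

open Set
open scoped RealInnerProductSpace

/-- A continuous convex function on a real normed space has a subgradient at every point. -/
theorem ConvexOn.exists_subgradient {G : Type*} [NormedAddCommGroup G] [NormedSpace ℝ G]
    {f : G → ℝ} (hf : ConvexOn ℝ univ f) (hcont : Continuous f) (x : G) :
    ∃ L : StrongDual ℝ G, ∀ h, f x + L h ≤ f (x + h) := by
  have hopen : IsOpen {p : G × ℝ | p.1 ∈ univ ∧ f p.1 < p.2} := by
    simpa using isOpen_lt (hcont.comp continuous_fst) continuous_snd
  obtain ⟨Φ, hΦ⟩ := geometric_hahn_banach_point_open (x := (x, f x)) hf.convex_strict_epigraph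
    hopen (by simp)
  have hsplit (v : G) (s : ℝ) : Φ (v, s) = Φ (v, 0) + s * Φ (0, 1) := by
    rw [← smul_eq_mul, ← map_smul, ← map_add]
    simp
  have hm : 0 < Φ (0, 1) := by
    have := hΦ (x, f x + 1) (by simp)
    rw [hsplit, hsplit x (f x + 1)] at this
    linarith
  refine ⟨-(Φ (0, 1))⁻¹ • Φ.comp (ContinuousLinearMap.inl ℝ G ℝ), fun h => ?_⟩
  refine le_of_forall_gt_imp_ge_of_dense fun s hs => ?_
  have := hΦ (x + h, s) (by simpa using hs)
  rw [hsplit, hsplit (x + h) s, show (x + h, (0 : ℝ)) = (x, 0) + (h, 0) by simp, map_add] at this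
  have key : (f x - s) * Φ (0, 1) ≤ Φ (h, 0) := by linarith
  have := (le_div_iff₀ hm).2 key
  simp only [smul_apply, ContinuousLinearMap.comp_apply,
    ContinuousLinearMap.inl_apply, smul_eq_mul]
  rw [div_eq_inv_mul] at this
  linarith

section

variable {E F : Type*} [NormedAddCommGroup E] [InnerProductSpace ℝ E]
  [NormedAddCommGroup F] [InnerProductSpace ℝ F]

/-- A function that is convex, and concave up to the quadratic form
`(α / 2) ‖·‖ ^ 2 + (β / 2) ‖·‖ ^ 2`, has at every point an affine minorant which is exact up to
that form. -/
theorem exists_strongDual_quadratic_bounds {α β : ℝ} {f : E × F → ℝ} (hcont : Continuous f)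
    (hf : ConvexOn ℝ univ f)
    (hf' : ConcaveOn ℝ univ fun p => f p - α / 2 * ‖p.1‖ ^ 2 - β / 2 * ‖p.2‖ ^ 2) (p : E × F) :
    ∃ L : StrongDual ℝ (E × F), ∀ h, f p + L h ≤ f (p + h) ∧
      f (p + h) ≤ f p + L h + (α / 2 * ‖h.1‖ ^ 2 + β / 2 * ‖h.2‖ ^ 2) := by
  obtain ⟨L, hL⟩ := hf.exists_subgradient hcont p
  obtain ⟨M, hM⟩ := hf'.neg.exists_subgradient (by simp only [Pi.neg_def]; fun_prop) p
  have hM' (h : E × F) : f (p + h) ≤ f p + (α * ⟪p.1, h.1⟫ + β * ⟪p.2, h.2⟫ - M h) +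
      (α / 2 * ‖h.1‖ ^ 2 + β / 2 * ‖h.2‖ ^ 2) := by
    have := hM h
    simp only [Pi.neg_apply, Prod.fst_add, Prod.snd_add, norm_add_sq_real] at this
    linarith
  refine ⟨L, fun h => ⟨hL h, (hM' h).trans ?_⟩⟩
  have hs (s : ℝ) (hs : 0 < s) : α * ⟪p.1, h.1⟫ + β * ⟪p.2, h.2⟫ - M h - L h ≤
      s * (α / 2 * ‖h.1‖ ^ 2 + β / 2 * ‖h.2‖ ^ 2) := by
    have h1 := (hL (-s • h)).trans (hM' (-s • h))
    simp only [map_smul, Prod.smul_fst, Prod.smul_snd, inner_smul_right, norm_smul, smul_eq_mul,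
      norm_neg, Real.norm_eq_abs, mul_pow, sq_abs] at h1
    refine le_of_mul_le_mul_left ?_ hs
    linarith
  have hlim : Filter.Tendsto (fun s : ℝ => s * (α / 2 * ‖h.1‖ ^ 2 + β / 2 * ‖h.2‖ ^ 2))
      (nhdsWithin 0 (Ioi 0)) (nhds 0) := by
    refine tendsto_nhdsWithin_of_tendsto_nhds ?_
    refine Continuous.tendsto' (by fun_prop) _ _ (by simp)
  have := ge_of_tendsto hlim (Filter.eventually_of_mem self_mem_nhdsWithin fun s h => hs s h)
  linarith

/-- A function whose first-order expansion has a quadratic error is differentiable. -/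
theorem hasFDerivAt_of_abs_sub_le_sq {G : Type*} [NormedAddCommGroup G] [NormedSpace ℝ G]
    {f : G → ℝ} {L : StrongDual ℝ G} {x : G} {K : ℝ}
    (h : ∀ v, |f (x + v) - f x - L v| ≤ K * ‖v‖ ^ 2) : HasFDerivAt f L x := by
  rw [hasFDerivAt_iff_isLittleO_nhds_zero]
  refine (Asymptotics.IsBigO.of_bound K (g := fun v : G => ‖v‖ ^ 2)
    (Filter.Eventually.of_forall fun v => ?_)).trans_isLittleO ?_
  · simpa using h v
  · exact Asymptotics.isLittleO_norm_pow_id one_lt_two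

theorem abs_le_of_forall_mul_le_sq {g A P Q : ℝ} (hA : 0 ≤ A) (hPQ : P * Q = A ^ 2)
    (h : ∀ s : ℝ, s * g ≤ s ^ 2 * (P / 2) + Q / 2) : |g| ≤ A := by
  have := discrim_le_zero (a := P / 2) (b := -g) (c := Q / 2) fun s => by nlinarith [h s]
  refine abs_le_of_sq_le_sq ?_ hA
  rw [discrim] at this
  nlinarith

end

/-- two-sided bounds on `⟨∇_x V_t(x,y) − ∇_x V_t(x',y'), x − x'⟩` for a
potential `V_t` with `c(1+ct)⁻¹ I_E ⊕ c I_F ≤ HV_t ≤ C(1+Ct)⁻¹ I_E ⊕ C I_F`. -/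
theorem stmt14 {E F : Type*}
    [NormedAddCommGroup E] [InnerProductSpace ℝ E] [FiniteDimensional ℝ E]
    [NormedAddCommGroup F] [InnerProductSpace ℝ F] [FiniteDimensional ℝ F]
    (c C t : ℝ) (hc : 0 < c) (hcC : c ≤ C) (ht : 0 ≤ t)
    (V : E × F → ℝ)
    (hconv : ConvexOn ℝ univ
      (fun p : E × F =>
        V p - c / (2 * (1 + c * t)) * ‖p.1‖ ^ 2 - c / 2 * ‖p.2‖ ^ 2))
    (hconc : ConcaveOn ℝ univ
      (fun p : E × F =>
        V p - C / (2 * (1 + C * t)) * ‖p.1‖ ^ 2 - C / 2 * ‖p.2‖ ^ 2)) :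
    ∀ (x x' : E) (y y' : F),
      (⟪gradient (fun a => V (a, y)) x - gradient (fun a => V (a, y')) x', x - x'⟫ ≤
        C / (1 + C * t) * ‖x - x'‖ ^ 2 +
          (C - c) / (Real.sqrt (1 + C * t) * Real.sqrt (1 + c * t)) *
            (‖x - x'‖ * ‖y - y'‖)) ∧
      (c / (1 + c * t) * ‖x - x'‖ ^ 2 -
          (C - c) / (Real.sqrt (1 + C * t) * Real.sqrt (1 + c * t)) *
            (‖x - x'‖ * ‖y - y'‖) ≤
        ⟪gradient (fun a => V (a, y)) x - gradient (fun a => V (a, y')) x', x - x'⟫) := by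
  have hct : 0 < 1 + c * t := by positivity
  have hC : 0 < C := hc.trans_le hcC
  have hCt : 0 < 1 + C * t := by positivity
  set a := c / (1 + c * t) with ha
  set b := C / (1 + C * t) with hb
  set κ := (C - c) / (Real.sqrt (1 + C * t) * Real.sqrt (1 + c * t)) with hκ
  have hκ0 : 0 ≤ κ := div_nonneg (sub_nonneg.2 hcC) (by positivity)
  have hκsq : κ ^ 2 = (b - a) * (C - c) := by
    rw [hκ, div_pow, mul_pow, Real.sq_sqrt hCt.le, Real.sq_sqrt hct.le, ha, hb]
    field_simp
    ring
  have ha2 : c / (2 * (1 + c * t)) = a / 2 := by rw [ha]; field_simp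
  have hb2 : C / (2 * (1 + C * t)) = b / 2 := by rw [hb]; field_simp
  rw [ha2] at hconv
  rw [hb2] at hconc
  set f : E × F → ℝ := fun p => V p - a / 2 * ‖p.1‖ ^ 2 - c / 2 * ‖p.2‖ ^ 2 with hf
  have hconc' : ConcaveOn ℝ univ
      fun p => f p - (b - a) / 2 * ‖p.1‖ ^ 2 - (C - c) / 2 * ‖p.2‖ ^ 2 := by
    convert hconc using 2 with p
    simp only [hf]
    ring
  choose L hL using
    exists_strongDual_quadratic_bounds hconv.locallyLipschitz.continuous hconv hconc'
  have hgrad (x : E) (y : F) (v : E) :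
      ⟪gradient (fun e => V (e, y)) x, v⟫ = L (x, y) (v, 0) + a * ⟪x, v⟫ := by
    have hd : HasFDerivAt (fun e => V (e, y))
        ((L (x, y)).comp (ContinuousLinearMap.inl ℝ E F) + a • innerSL ℝ x) x := by
      refine hasFDerivAt_of_abs_sub_le_sq (K := |a| / 2 + |b| / 2) fun v => ?_
      have h1 := hL (x, y) (v, 0)
      simp only [hf, Prod.mk_add_mk, add_zero, norm_add_sq_real, norm_zero] at h1
      simp only [add_apply, ContinuousLinearMap.comp_apply,
        ContinuousLinearMap.inl_apply, smul_apply, innerSL_apply_apply,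
        smul_eq_mul]
      have hv := sq_nonneg ‖v‖
      have := mul_le_mul_of_nonneg_right (neg_abs_le a) hv
      have := mul_le_mul_of_nonneg_right (le_abs_self b) hv
      have := mul_nonneg (abs_nonneg a) hv
      have := mul_nonneg (abs_nonneg b) hv
      rw [abs_le]
      constructor <;> linarith [h1.1, h1.2]
    rw [gradient, InnerProductSpace.toDual_symm_apply, hd.fderiv]
    simp
  have hdiff (p q k : E × F) : L p k - L q k ≤
      ((b - a) / 2 * ‖k.1‖ ^ 2 + (C - c) / 2 * ‖k.2‖ ^ 2) +
      ((b - a) / 2 * ‖(q - p).1‖ ^ 2 + (C - c) / 2 * ‖(q - p).2‖ ^ 2) := by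
    have h1 := (hL q k).2
    have h2 := (hL p (q - p)).2
    have h3 := (hL p (q + k - p)).1
    rw [add_sub_cancel] at h2 h3
    rw [add_sub_right_comm, map_add] at h3
    linarith
  intro x x' y y'
  have hfst_le : L (x, y) (x - x', 0) - L (x', y) (x - x', 0) ≤ (b - a) * ‖x - x'‖ ^ 2 := by
    have := hdiff (x, y) (x', y) (x - x', 0)
    simp only [Prod.mk_sub_mk, sub_self, norm_zero, norm_sub_rev x' x] at this
    linarith
  have hfst_nonneg : 0 ≤ L (x, y) (x - x', 0) - L (x', y) (x - x', 0) := by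
    have h1 := (hL (x', y) (x - x', 0)).1
    have h2 := (hL (x, y) (-(x - x', 0))).1
    rw [map_neg] at h2
    simp only [Prod.neg_mk, Prod.mk_add_mk, neg_sub, neg_zero, add_zero, add_sub_cancel] at h1 h2
    linarith
  have hsnd : |L (x', y) (x - x', 0) - L (x', y') (x - x', 0)| ≤
      κ * (‖x - x'‖ * ‖y - y'‖) := by
    refine abs_le_of_forall_mul_le_sq (P := (b - a) * ‖x - x'‖ ^ 2)
      (Q := (C - c) * ‖y - y'‖ ^ 2) (by positivity) ?_ fun s => ?_
    · rw [mul_pow, hκsq]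
      ring
    · have := hdiff (x', y) (x', y') (s • (x - x', 0))
      rw [map_smul, map_smul] at this
      simp only [smul_eq_mul, Prod.smul_mk, smul_zero, norm_smul, Real.norm_eq_abs,
        mul_pow, sq_abs, Prod.mk_sub_mk, sub_self, norm_zero, norm_sub_rev y' y] at this
      linarith
  have hsum : ⟪gradient (fun e => V (e, y)) x - gradient (fun e => V (e, y')) x', x - x'⟫ =
      (L (x, y) (x - x', 0) - L (x', y) (x - x', 0)) +
      (L (x', y) (x - x', 0) - L (x', y') (x - x', 0)) + a * ‖x - x'‖ ^ 2 := by
    rw [inner_sub_left, hgrad, hgrad, ← real_inner_self_eq_norm_sq (x - x'),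
      inner_sub_left x x' (x - x')]
    ring
  rw [hsum]
  obtain ⟨hlo, hhi⟩ := abs_le.1 hsnd
  constructor <;> linarith
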